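/- arXiv:1509.00370 — 2 statements merged into one kernel-verified Lean document; each statement's English description precedes it below -/
import Mathlib

section
/- Let n₁, n₂ ≥ 1 and let G be a finite tree with |E(G)| = n₁ + n₂ − 1. Suppose there exist two subtrees H₁ and H₂ of G whose edge sets intersect in exactly one edge and satisfy |E(H₁)| = n₁ and |E(H₂)| = n₂. Then CB(n₁,n₂) is friendly to G. -/
open SimpleGraph

/-- `p` does not catch `q` in `G`: they are disjoint and for any two distinct edges of `p`,
the path in `G` between them contains an even number of edges of `q`. -/
def DoesNotCatch {V : Type*} (G : SimpleGraph V) (p q : Set (Sym2 V)) : Prop :=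
  p ∩ q = ∅ ∧
    ∀ e ∈ p, ∀ f ∈ p, e ≠ f →
      ∀ (u v : V) (w : G.Walk u v), w.IsPath → u ∈ e → v ∈ f →
        e ∉ w.edges → f ∉ w.edges →
        Even (w.edges.countP (fun x => @decide (x ∈ q) (Classical.propDecidable _)))

/-- `p` and `q` are unlinked in `G`. -/
def Unlinked {V : Type*} (G : SimpleGraph V) (p q : Set (Sym2 V)) : Prop :=
  DoesNotCatch G p q ∧ DoesNotCatch G q p

/-- Image of a set of edges of `G₁` under a map of edge sets. -/
def edgeImage {V₁ V₂ : Type*} {G₁ : SimpleGraph V₁} {G₂ : SimpleGraph V₂}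
    (φ : G₁.edgeSet → G₂.edgeSet) (s : Set (Sym2 V₁)) : Set (Sym2 V₂) :=
  {e₂ | ∃ e₁ : G₁.edgeSet, (e₁ : Sym2 V₁) ∈ s ∧ (φ e₁ : Sym2 V₂) = e₂}

/-- A bijection of edge sets is friendly if the images of the coboundaries (incidence sets)
of any two distinct vertices at even distance are unlinked. -/
def FriendlyBij {V₁ V₂ : Type*} (G₁ : SimpleGraph V₁) (G₂ : SimpleGraph V₂)
    (φ : G₁.edgeSet ≃ G₂.edgeSet) : Prop :=
  ∀ P Q : V₁, P ≠ Q → Even (G₁.dist P Q) →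
    Unlinked G₂ (edgeImage φ (G₁.incidenceSet P)) (edgeImage φ (G₁.incidenceSet Q))

/-- `G₁` is friendly to `G₂`. -/
def Friendly {V₁ V₂ : Type*} (G₁ : SimpleGraph V₁) (G₂ : SimpleGraph V₂) : Prop :=
  ∃ φ : G₁.edgeSet ≃ G₂.edgeSet, FriendlyBij G₁ G₂ φ

/-- The tree `CB n₁ n₂`: two adjacent centers `0` and `1` of degrees `n₁` and `n₂`,
all other vertices being leaves. -/
def CB (n₁ n₂ : ℕ) : SimpleGraph (Fin (n₁ + n₂)) :=
  SimpleGraph.fromRel (fun a b =>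
    (a.val = 0 ∧ b.val = 1) ∨ (a.val = 0 ∧ 2 ≤ b.val ∧ b.val ≤ n₁) ∨
    (a.val = 1 ∧ n₁ + 1 ≤ b.val))

/-- The subgraph of `G` spanned by the edge set `F` is connected: any two of its vertices
are joined by a walk using only edges of `F`. -/
def SpannedConnected {V : Type*} (G : SimpleGraph V) (F : Set (Sym2 V)) : Prop :=
  ∀ x y : V, (∃ e ∈ F, x ∈ e) → (∃ e ∈ F, y ∈ e) →
    ∃ w : G.Walk x y, ∀ e ∈ w.edges, e ∈ F

/-- In an acyclic graph, a set of edges spanning a connected subgraph does not catch any set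
of edges disjoint from it. -/
theorem SpannedConnected.doesNotCatch {V : Type*} {G : SimpleGraph V} (hG : G.IsAcyclic)
    {p q : Set (Sym2 V)} (hp : SpannedConnected G p) (hpq : p ∩ q = ∅) :
    DoesNotCatch G p q := by
  classical
  refine ⟨hpq, fun e he f hf _ u v w hw hu hv _ _ => ?_⟩
  obtain ⟨w', hw'⟩ := hp u v ⟨e, he, hu⟩ ⟨f, hf, hv⟩
  have hww : w = w'.bypass :=
    congrArg Subtype.val ((hG.subsingleton_path u v).elim ⟨w, hw⟩ ⟨w'.bypass, w'.bypass_isPath⟩)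
  have hcount : w.edges.countP (fun x => @decide (x ∈ q) (Classical.propDecidable _)) = 0 := by
    refine List.countP_eq_zero.2 fun x hx => ?_
    have hxp : x ∈ p := hw' x (w'.edges_bypass_subset_edges (hww ▸ hx))
    simpa using fun hxq : x ∈ q => (hpq ▸ ⟨hxp, hxq⟩ : x ∈ (∅ : Set (Sym2 V)))
  rw [hcount]
  exact Even.zero

/-- A set consisting of at most one edge spans a connected subgraph. -/
theorem spannedConnected_of_subsingleton {V : Type*} {G : SimpleGraph V} {p : Set (Sym2 V)}
    (hpG : p ⊆ G.edgeSet) (hp : p.Subsingleton) : SpannedConnected G p := by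
  rintro x y ⟨e, he, hx⟩ ⟨f, hf, hy⟩
  obtain rfl := hp he hf
  by_cases hxy : x = y
  · subst hxy
    exact ⟨Walk.nil, by simp⟩
  · have hexy : e = s(x, y) := (Sym2.mem_and_mem_iff hxy).1 ⟨hx, hy⟩
    subst hexy
    have hadj : G.Adj x y := hpG he
    exact ⟨hadj.toWalk, by simpa using he⟩

/-- A bijection onto an acyclic graph sending every incidence set to a connected edge set is
friendly. -/
theorem friendlyBij_of_spannedConnected {V₁ V₂ : Type*} {G₁ : SimpleGraph V₁}
    {G₂ : SimpleGraph V₂} (hG₂ : G₂.IsAcyclic) (φ : G₁.edgeSet ≃ G₂.edgeSet)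
    (hφ : ∀ P, SpannedConnected G₂ (edgeImage φ (G₁.incidenceSet P))) :
    FriendlyBij G₁ G₂ φ := by
  intro P Q hPQ heven
  have hadj : ¬ G₁.Adj P Q := fun h => by
    rw [dist_eq_one_iff_adj.2 h] at heven
    exact absurd heven (by decide)
  have hdisj : edgeImage φ (G₁.incidenceSet P) ∩ edgeImage φ (G₁.incidenceSet Q) = ∅ := by
    rw [Set.eq_empty_iff_forall_notMem]
    rintro _ ⟨⟨e, he, rfl⟩, ⟨f, hf, hef⟩⟩
    obtain rfl : f = e := φ.injective (Subtype.ext hef)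
    exact Set.eq_empty_iff_forall_notMem.1
      (G₁.incidenceSet_inter_incidenceSet_of_not_adj hadj hPQ) f ⟨he, hf⟩
  exact ⟨(hφ P).doesNotCatch hG₂ hdisj, (hφ Q).doesNotCatch hG₂ (by rwa [Set.inter_comm])⟩

/-- Two types covered by a pair of finite sets with matching cardinalities admit a bijection
matching the pairs. -/
theorem exists_equiv_mem_iff_mem {α β : Type*} [Fintype α] [Fintype β]
    [DecidableEq α] [DecidableEq β] {A₁ A₂ : Finset α} {B₁ B₂ : Finset β}
    (hA : A₁ ∪ A₂ = Finset.univ) (hB : B₁ ∪ B₂ = Finset.univ)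
    (h₁ : A₁.card = B₁.card) (h₂ : A₂.card = B₂.card)
    (h₁₂ : (A₁ ∩ A₂).card = (B₁ ∩ B₂).card) :
    ∃ φ : α ≃ β, ∀ a, (φ a ∈ B₁ ↔ a ∈ A₁) ∧ (φ a ∈ B₂ ↔ a ∈ A₂) := by
  let f : α → Bool × Bool := fun a => (decide (a ∈ A₁), decide (a ∈ A₂))
  let g : β → Bool × Bool := fun b => (decide (b ∈ B₁), decide (b ∈ B₂))
  have key : ∀ c, Fintype.card {a // f a = c} = Fintype.card {b // g b = c} := by
    have hA' : ∀ a, a ∈ A₁ ∨ a ∈ A₂ := fun a => by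
      rw [← Finset.mem_union, hA]; exact Finset.mem_univ a
    have hB' : ∀ b, b ∈ B₁ ∨ b ∈ B₂ := fun b => by
      rw [← Finset.mem_union, hB]; exact Finset.mem_univ b
    rintro ⟨_ | _, _ | _⟩
    · rw [Fintype.card_of_subtype (∅ : Finset α) (by grind),
        Fintype.card_of_subtype (∅ : Finset β) (by grind)]
      rfl
    · rw [Fintype.card_of_subtype (A₂ \ A₁) (by grind),
        Fintype.card_of_subtype (B₂ \ B₁) (by grind), Finset.card_sdiff, Finset.card_sdiff,
        h₁₂, h₂]
    · rw [Fintype.card_of_subtype (A₁ \ A₂) (by grind),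
        Fintype.card_of_subtype (B₁ \ B₂) (by grind), Finset.card_sdiff, Finset.card_sdiff,
        Finset.inter_comm A₂, Finset.inter_comm B₂, h₁₂, h₁]
    · rw [Fintype.card_of_subtype (A₁ ∩ A₂) (by grind),
        Fintype.card_of_subtype (B₁ ∩ B₂) (by grind), h₁₂]
  let φ : α ≃ β := Equiv.ofFiberEquiv fun c => Fintype.equivOfCardEq (key c)
  refine ⟨φ, fun a => ?_⟩
  have hφ : g (φ a) = f a := Equiv.ofFiberEquiv_map _ a
  simpa [f, g] using hφ

theorem card_subtype_of_subset {α : Type*} {S : Set α} [DecidablePred (· ∈ S)] {C : Finset α}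
    (h : (C : Set α) ⊆ S) : (C.subtype (· ∈ S)).card = C.card := by
  rw [Finset.card_subtype, Finset.filter_true_of_mem fun x hx => h hx]

/-- The version of `exists_equiv_mem_iff_mem` for subtypes. -/
theorem exists_equiv_coe_mem_iff_mem {α β : Type*} [DecidableEq α] [DecidableEq β]
    {S : Set α} {T : Set β} {A₁ A₂ : Finset α} {B₁ B₂ : Finset β}
    (hA : (A₁ ∪ A₂ : Set α) = S) (hB : (B₁ ∪ B₂ : Set β) = T)
    (h₁ : A₁.card = B₁.card) (h₂ : A₂.card = B₂.card)
    (h₁₂ : (A₁ ∩ A₂).card = (B₁ ∩ B₂).card) :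
    ∃ φ : S ≃ T, ∀ a, ((φ a : β) ∈ B₁ ↔ (a : α) ∈ A₁) ∧ ((φ a : β) ∈ B₂ ↔ (a : α) ∈ A₂) := by
  classical
  have hA₁ : (A₁ : Set α) ⊆ S := hA ▸ Set.subset_union_left
  have hA₂ : (A₂ : Set α) ⊆ S := hA ▸ Set.subset_union_right
  have hB₁ : (B₁ : Set β) ⊆ T := hB ▸ Set.subset_union_left
  have hB₂ : (B₂ : Set β) ⊆ T := hB ▸ Set.subset_union_right
  have : Fintype S := ((A₁.finite_toSet.union A₂.finite_toSet).subset hA.ge).fintype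
  have : Fintype T := ((B₁.finite_toSet.union B₂.finite_toSet).subset hB.ge).fintype
  have hAi : A₁.subtype (· ∈ S) ∩ A₂.subtype (· ∈ S) = (A₁ ∩ A₂).subtype (· ∈ S) := by
    ext x; simp
  have hBi : B₁.subtype (· ∈ T) ∩ B₂.subtype (· ∈ T) = (B₁ ∩ B₂).subtype (· ∈ T) := by
    ext x; simp
  obtain ⟨φ, hφ⟩ := exists_equiv_mem_iff_mem
    (A₁ := A₁.subtype (· ∈ S)) (A₂ := A₂.subtype (· ∈ S))
    (B₁ := B₁.subtype (· ∈ T)) (B₂ := B₂.subtype (· ∈ T))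
    (by ext ⟨x, hx⟩; simpa [← hA] using hx) (by ext ⟨x, hx⟩; simpa [← hB] using hx)
    (by rw [card_subtype_of_subset hA₁, card_subtype_of_subset hB₁, h₁])
    (by rw [card_subtype_of_subset hA₂, card_subtype_of_subset hB₂, h₂])
    (by
      rw [hAi, hBi, card_subtype_of_subset, card_subtype_of_subset, h₁₂]
      · exact fun x hx => hB₁ (Finset.mem_of_mem_inter_left hx)
      · exact fun x hx => hA₁ (Finset.mem_of_mem_inter_left hx))
  exact ⟨φ, fun a => by simpa using hφ a⟩

theorem CB_adj_zero_iff {n₁ n₂ : ℕ} {a b : Fin (n₁ + n₂)} (ha : a.val = 0) (h₁ : 1 ≤ n₁) :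
    (CB n₁ n₂).Adj a b ↔ 1 ≤ b.val ∧ b.val ≤ n₁ := by
  simp only [CB, fromRel_adj, ne_eq, Fin.ext_iff]
  omega

theorem CB_adj_one_iff {n₁ n₂ : ℕ} {a b : Fin (n₁ + n₂)} (ha : a.val = 1) (h₁ : 1 ≤ n₁) :
    (CB n₁ n₂).Adj a b ↔ b.val = 0 ∨ n₁ < b.val := by
  simp only [CB, fromRel_adj, ne_eq, Fin.ext_iff]
  omega

theorem CB_degree_zero {n₁ n₂ : ℕ} [DecidableRel (CB n₁ n₂).Adj] {a : Fin (n₁ + n₂)}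
    (ha : a.val = 0) (h₁ : 1 ≤ n₁) (h₂ : 1 ≤ n₂) : (CB n₁ n₂).degree a = n₁ := by
  have h : (CB n₁ n₂).neighborFinset a =
      Finset.Icc ⟨1, by omega⟩ ⟨n₁, by omega⟩ := by
    ext b
    simp [CB_adj_zero_iff ha h₁, Fin.le_def]
  rw [← card_neighborFinset_eq_degree, h, Fin.card_Icc]
  simp

theorem CB_degree_one {n₁ n₂ : ℕ} [DecidableRel (CB n₁ n₂).Adj] {a : Fin (n₁ + n₂)}
    (ha : a.val = 1) (h₁ : 1 ≤ n₁) (h₂ : 1 ≤ n₂) : (CB n₁ n₂).degree a = n₂ := by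
  have h : (CB n₁ n₂).neighborFinset a =
      insert ⟨0, by omega⟩ (Finset.Ioi ⟨n₁, by omega⟩) := by
    ext b
    simp [CB_adj_one_iff ha h₁, Fin.lt_def, Fin.ext_iff]
  rw [← card_neighborFinset_eq_degree, h, Finset.card_insert_of_notMem (by simp), Fin.card_Ioi]
  simp only
  omega

/-- Every edge of `CB n₁ n₂` is incident to one of the two centers. -/
theorem CB_incidenceSet_union {n₁ n₂ : ℕ} {a b : Fin (n₁ + n₂)} (ha : a.val = 0)
    (hb : b.val = 1) :
    (CB n₁ n₂).incidenceSet a ∪ (CB n₁ n₂).incidenceSet b = (CB n₁ n₂).edgeSet := by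
  refine Set.Subset.antisymm
    (Set.union_subset (incidenceSet_subset _ _) (incidenceSet_subset _ _)) fun e he => ?_
  induction e with | _ x y =>
  have hxy : (CB n₁ n₂).Adj x y := he
  simp only [Set.mem_union, mk'_mem_incidenceSet_iff, hxy, true_and]
  simp only [CB, fromRel_adj, ne_eq, Fin.ext_iff] at hxy ⊢
  omega

/-- A vertex of `CB n₁ n₂` which is not a center is incident to at most one edge. -/
theorem CB_incidenceSet_subsingleton {n₁ n₂ : ℕ} {P : Fin (n₁ + n₂)} (h₀ : P.val ≠ 0)
    (h₁ : P.val ≠ 1) : ((CB n₁ n₂).incidenceSet P).Subsingleton := by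
  rintro e ⟨he, hPe⟩ f ⟨hf, hPf⟩
  obtain ⟨x, rfl⟩ := hPe
  obtain ⟨y, rfl⟩ := hPf
  rw [mem_edgeSet, CB, fromRel_adj] at he hf
  congr 2
  rw [Fin.ext_iff]
  omega

theorem edgeImage_eq {V₁ V₂ : Type*} {G₁ : SimpleGraph V₁} {G₂ : SimpleGraph V₂}
    (φ : G₁.edgeSet ≃ G₂.edgeSet) {s : Set (Sym2 V₁)} {t : Set (Sym2 V₂)}
    (ht : t ⊆ G₂.edgeSet) (h : ∀ e, (φ e : Sym2 V₂) ∈ t ↔ (e : Sym2 V₁) ∈ s) :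
    edgeImage φ s = t := by
  ext e₂
  constructor
  · rintro ⟨e₁, he₁, rfl⟩
    exact (h e₁).2 he₁
  · intro he₂
    refine ⟨φ.symm ⟨e₂, ht he₂⟩, (h _).1 ?_, ?_⟩ <;> simp [he₂]

/-- **Sufficiency.** If a finite tree `G` with `n₁ + n₂ - 1` edges contains two subtrees
(connected edge sets) of sizes `n₁` and `n₂` meeting in exactly one edge, then
`CB n₁ n₂` is friendly to `G`. -/
theorem cb_friendly_of_subtrees {V : Type*} [Fintype V] [DecidableEq V]
    (G : SimpleGraph V) [DecidableRel G.Adj] (hT : G.IsTree)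
    (n₁ n₂ : ℕ) (h₁ : 1 ≤ n₁) (h₂ : 1 ≤ n₂)
    (hcard : G.edgeFinset.card = n₁ + n₂ - 1)
    (hsub : ∃ E₁ E₂ : Finset (Sym2 V), ↑E₁ ⊆ G.edgeSet ∧ ↑E₂ ⊆ G.edgeSet ∧
      (E₁ ∩ E₂).card = 1 ∧ E₁.card = n₁ ∧ E₂.card = n₂ ∧
      SpannedConnected G ↑E₁ ∧ SpannedConnected G ↑E₂) :
    Friendly (CB n₁ n₂) G := by
  classical
  obtain ⟨E₁, E₂, hE₁, hE₂, hE, rfl, rfl, hc₁, hc₂⟩ := hsub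
  let a : Fin (E₁.card + E₂.card) := ⟨0, by omega⟩
  let b : Fin (E₁.card + E₂.card) := ⟨1, by omega⟩
  have hEG : (E₁ ∪ E₂ : Set (Sym2 V)) = G.edgeSet := by
    rw [← Finset.coe_union, ← coe_edgeFinset, Finset.coe_inj]
    refine Finset.eq_of_subset_of_card_le (fun e he => ?_) ?_
    · rw [mem_edgeFinset]
      exact (Finset.mem_union.1 he).elim (@hE₁ e) (@hE₂ e)
    · have := Finset.card_union_add_card_inter E₁ E₂
      omega
  have hinter : (CB E₁.card E₂.card).incidenceFinset a ∩
      (CB E₁.card E₂.card).incidenceFinset b = {s(a, b)} := by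
    rw [← Finset.coe_inj, Finset.coe_inter, coe_incidenceFinset, coe_incidenceFinset,
      Finset.coe_singleton]
    exact incidenceSet_inter_incidenceSet_of_adj _ ((CB_adj_zero_iff rfl h₁).2 ⟨le_rfl, h₁⟩)
  obtain ⟨φ, hφ⟩ := exists_equiv_coe_mem_iff_mem
    (S := (CB E₁.card E₂.card).edgeSet) (A₁ := (CB E₁.card E₂.card).incidenceFinset a)
    (A₂ := (CB E₁.card E₂.card).incidenceFinset b)
    (by rw [coe_incidenceFinset, coe_incidenceFinset]; exact CB_incidenceSet_union rfl rfl) hEG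
    (by rw [card_incidenceFinset_eq_degree, CB_degree_zero rfl h₁ h₂])
    (by rw [card_incidenceFinset_eq_degree, CB_degree_one rfl h₁ h₂])
    (by rw [hinter, hE, Finset.card_singleton])
  refine ⟨φ, friendlyBij_of_spannedConnected hT.isAcyclic φ fun P => ?_⟩
  by_cases hPa : P = a
  · rw [hPa, edgeImage_eq φ hE₁ fun e => by simpa using (hφ e).1]
    exact hc₁
  by_cases hPb : P = b
  · rw [hPb, edgeImage_eq φ hE₂ fun e => by simpa using (hφ e).2]
    exact hc₂
  refine spannedConnected_of_subsingleton ?_ ?_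
  · rintro _ ⟨e, _, rfl⟩
    exact (φ e).2
  · rintro _ ⟨e, he, rfl⟩ _ ⟨f, hf, rfl⟩
    have hef : e = f := Subtype.ext <| CB_incidenceSet_subsingleton
      (fun h => hPa (Fin.ext h)) (fun h => hPb (Fin.ext h)) he hf
    rw [hef]
end

section
/- There exists a finite tree G with 9 edges (the same number of edges as CB(5,5)) such that CB(5,5) is not friendly to G. -/
open SimpleGraph

namespace SimpleGraph

/-- If `P` catches no single edge outside `P`, then a path whose first and last edges lie in `P`
has all its edges in `P`. -/
lemma mem_of_doesNotCatch_singleton {V : Type*} {G : SimpleGraph V} {P : Set (Sym2 V)}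
    (hP : ∀ b ∈ G.edgeSet, b ∉ P → DoesNotCatch G P {b}) {u' u v v' : V}
    (hu : G.Adj u' u) (w : G.Walk u v) (hv : G.Adj v v')
    (hpath : (Walk.cons hu (w.concat hv)).IsPath) (hfirst : s(u', u) ∈ P) (hlast : s(v, v') ∈ P) :
    ∀ b ∈ w.edges, b ∈ P := by
  intro b hb
  by_contra hbP
  have hnodup := hpath.isTrail.edges_nodup
  simp only [Walk.edges_cons, Walk.edges_concat, List.concat_eq_append, List.nodup_cons,
    List.mem_append, List.mem_singleton, not_or, List.nodup_append] at hnodup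
  obtain ⟨⟨he, hne⟩, hwn, -, hf⟩ := hnodup
  have hw : w.IsPath := by
    have h := hpath.of_cons
    rw [Walk.concat_eq_append] at h
    exact h.of_append_left
  have hcount := (hP b (w.edges_subset_edgeSet hb) hbP).2 _ hfirst _ hlast hne u v w hw
    (Sym2.mem_mk_right _ _) (Sym2.mem_mk_left _ _) he (fun h => hf _ h _ rfl rfl)
  classical
  have hone : w.edges.count b = 1 := List.count_eq_one_of_mem hwn hb
  have heq : w.edges.countP (fun x => @decide (x ∈ ({b} : Set (Sym2 V)))
      (Classical.propDecidable _)) = 1 := by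
    rw [← hone, List.count]
    refine List.countP_congr fun x _ => ?_
    simp
  rw [heq] at hcount
  exact absurd hcount (by decide)

/-- Suppose that `P` and `Q` cover the edges and neither catches a single edge outside itself.
After a first edge common to `P` and `Q`, the edges of a path lie either all in `P` or all
in `Q`. -/
lemma edges_subset_or_subset {V : Type*} {G : SimpleGraph V} {P Q : Set (Sym2 V)}
    (hP : ∀ b ∈ G.edgeSet, b ∉ P → DoesNotCatch G P {b})
    (hQ : ∀ b ∈ G.edgeSet, b ∉ Q → DoesNotCatch G Q {b})
    (hPQ : G.edgeSet ⊆ P ∪ Q) {u v x : V} (h : G.Adj u v) (w : G.Walk v x)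
    (hpath : (Walk.cons h w).IsPath) (hc : s(u, v) ∈ P ∩ Q) :
    (∀ e ∈ w.edges, e ∈ P) ∨ (∀ e ∈ w.edges, e ∈ Q) := by
  cases w with
  | nil => simp
  | cons h' w' =>
    obtain ⟨y, w, hy, hw⟩ := Walk.exists_cons_eq_concat h' w'
    rw [hw] at hpath ⊢
    simp only [Walk.edges_concat, List.concat_eq_append, List.mem_append, List.mem_singleton]
    rcases hPQ (G.mem_edgeSet.2 hy) with hl | hl
    · left
      rintro e (he | rfl)
      · exact mem_of_doesNotCatch_singleton hP h w hy hpath hc.1 hl e he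
      · exact hl
    · right
      rintro e (he | rfl)
      · exact mem_of_doesNotCatch_singleton hQ h w hy hpath hc.2 hl e he
      · exact hl

end SimpleGraph

lemma cb55_adj_iff (a b : Fin (5 + 5)) : (CB 5 5).Adj a b ↔
    a ≠ b ∧ (((a.val = 0 ∧ b.val = 1) ∨ (a.val = 0 ∧ 2 ≤ b.val ∧ b.val ≤ 5) ∨
      (a.val = 1 ∧ 6 ≤ b.val)) ∨ ((b.val = 0 ∧ a.val = 1) ∨
      (b.val = 0 ∧ 2 ≤ a.val ∧ a.val ≤ 5) ∨ (b.val = 1 ∧ 6 ≤ a.val))) :=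
  Iff.rfl

instance : DecidableRel (CB 5 5).Adj := fun a b => decidable_of_iff _ (cb55_adj_iff a b).symm

lemma even_dist_of_common_neighbor {V : Type*} {G : SimpleGraph V} {x y z : V} (hxy : G.Adj x y)
    (hyz : G.Adj y z) (hxz : x ≠ z) (hn : ¬ G.Adj x z) : Even (G.dist x z) := by
  have hle : G.dist x z ≤ 2 := G.dist_le (Walk.cons hxy (Walk.cons hyz Walk.nil))
  have h0 : G.dist x z ≠ 0 := fun h =>
    hxz (((Walk.cons hxy (Walk.cons hyz Walk.nil)).reachable).dist_eq_zero_iff.1 h)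
  have h1 : G.dist x z ≠ 1 := fun h => hn (SimpleGraph.dist_eq_one_iff_adj.1 h)
  have : G.dist x z = 2 := by omega
  rw [this]; decide

/-- Under a friendly bijection from `CB 5 5`, the image of the coboundary of a center catches no
single edge outside it. -/
lemma FriendlyBij.doesNotCatch_singleton {V : Type*} {G : SimpleGraph V}
    {φ : (CB 5 5).edgeSet ≃ G.edgeSet} (hφ : FriendlyBij (CB 5 5) G φ) {x y : Fin (5 + 5)}
    (hxy : x = 0 ∧ y = 1 ∨ x = 1 ∧ y = 0) (b : Sym2 V) (hb : b ∈ G.edgeSet)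
    (hbx : b ∉ edgeImage φ ((CB 5 5).incidenceSet x)) :
    DoesNotCatch G (edgeImage φ ((CB 5 5).incidenceSet x)) {b} := by
  obtain ⟨⟨e, he⟩, hφe⟩ := φ.surjective ⟨b, hb⟩
  have hex : x ∉ e := fun h => hbx ⟨⟨e, he⟩, ⟨he, h⟩, by rw [hφe]⟩
  have hleaf : ∃ z, (CB 5 5).Adj y z ∧ e = s(y, z) ∧ x ≠ z ∧ ¬ (CB 5 5).Adj x z ∧
      ∀ t, (CB 5 5).Adj z t → t = y := by
    clear hφe hbx
    induction e using Sym2.ind with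
    | _ s t =>
      rw [SimpleGraph.mem_edgeSet] at he
      rw [Sym2.mem_iff, not_or] at hex
      have key : ∀ x y : Fin (5 + 5), (x = 0 ∧ y = 1 ∨ x = 1 ∧ y = 0) → ∀ s t : Fin (5 + 5),
          (CB 5 5).Adj s t → x ≠ s → x ≠ t →
          ((y = s ∧ ¬ (CB 5 5).Adj x t ∧ ∀ r, (CB 5 5).Adj t r → r = y) ∨
          (y = t ∧ ¬ (CB 5 5).Adj x s ∧ ∀ r, (CB 5 5).Adj s r → r = y)) := by
        decide
      rcases key x y hxy s t he hex.1 hex.2 with ⟨rfl, h1, h2⟩ | ⟨rfl, h1, h2⟩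
      · exact ⟨t, he, rfl, hex.2, h1, h2⟩
      · exact ⟨s, he.symm, Sym2.eq_swap, hex.1, h1, h2⟩
  obtain ⟨z, hyz, rfl, hxz, hn, huniq⟩ := hleaf
  have hadj : (CB 5 5).Adj x y := by
    rcases hxy with ⟨rfl, rfl⟩ | ⟨rfl, rfl⟩ <;> decide
  have himage : edgeImage φ ((CB 5 5).incidenceSet z) = {b} := by
    ext f
    simp only [edgeImage, Set.mem_ofPred_eq, Set.mem_singleton_iff]
    constructor
    · rintro ⟨⟨e', he'⟩, ⟨-, hz⟩, rfl⟩
      obtain ⟨t, rfl⟩ := Sym2.mem_iff_exists.1 hz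
      obtain rfl := huniq t he'
      have : (⟨s(z, t), he'⟩ : (CB 5 5).edgeSet) = ⟨s(t, z), he⟩ := Subtype.ext Sym2.eq_swap
      rw [this, hφe]
    · rintro rfl
      exact ⟨⟨s(y, z), he⟩, ⟨he, Sym2.mem_mk_right _ _⟩, by rw [hφe]⟩
  rw [← himage]
  exact (hφ x z hxz (even_dist_of_common_neighbor hadj hyz hxz hn)).1

lemma ncard_edgeImage {V₁ V₂ : Type*} {G₁ : SimpleGraph V₁} {G₂ : SimpleGraph V₂}
    (φ : G₁.edgeSet ≃ G₂.edgeSet) {s : Set (Sym2 V₁)} (hs : s ⊆ G₁.edgeSet) :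
    (edgeImage φ s).ncard = s.ncard := by
  have h : edgeImage φ s = (Subtype.val ∘ φ) '' (Subtype.val ⁻¹' s) := by
    ext; simp [edgeImage]
  rw [h, Set.ncard_image_of_injective _ (Subtype.val_injective.comp φ.injective),
    ← Set.ncard_image_of_injective _ Subtype.val_injective, Subtype.image_preimage_coe,
    Set.inter_eq_right.2 hs]

/-- The parent of a vertex in the spider with center `0` and legs `1, 2, 3`, `4, 5, 6` and
`7, 8, 9`. -/
def spiderParent : Fin 10 → Fin 10 := ![0, 0, 1, 2, 0, 4, 5, 0, 7, 8]

/-- The spider with three legs of length `3`. -/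
def spider : SimpleGraph (Fin 10) where
  Adj a b := a ≠ b ∧ (spiderParent a = b ∨ spiderParent b = a)
  symm := ⟨fun _ _ h => ⟨h.1.symm, h.2.symm⟩⟩
  loopless := ⟨fun _ h => h.1 rfl⟩

instance : DecidableRel spider.Adj := fun a b =>
  inferInstanceAs (Decidable (a ≠ b ∧ (spiderParent a = b ∨ spiderParent b = a)))

lemma spider_edge_eq {e : Sym2 (Fin 10)} (he : e ∈ spider.edgeSet) :
    ∃ i, i ≠ 0 ∧ e = s(i, spiderParent i) := by
  revert e; decide

lemma spider_edgeFinset_card : spider.edgeFinset.card = 9 := by decide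

lemma spider_isTree : spider.IsTree := by
  have hreach : ∀ v, spider.Reachable v 0 := by
    intro v
    induction v using WellFoundedLT.induction with
    | _ v ih =>
      by_cases hv : v = 0
      · rw [hv]
      · have h : ∀ v : Fin 10, v ≠ 0 → spider.Adj v (spiderParent v) ∧ spiderParent v < v := by
          decide
        exact (h v hv).1.reachable.trans (ih _ (h v hv).2)
  rw [isTree_iff_connected_and_card]
  refine ⟨⟨fun u v => (hreach u).trans (hreach v).symm⟩, ?_⟩
  rw [Nat.card_eq_fintype_card, ← edgeFinset_card, spider_edgeFinset_card]
  simp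

lemma ncard_subset_spider_edgeSet {P : Set (Sym2 (Fin 10))} [DecidablePred (· ∈ P)]
    (hP : P ⊆ spider.edgeSet) :
    P.ncard = ∑ i : Fin 9, if s(i.succ, spiderParent i.succ) ∈ P then 1 else 0 := by
  have himage : P = ((Finset.univ.filter fun i : Fin 9 => s(i.succ, spiderParent i.succ) ∈ P).image
      fun i => s(i.succ, spiderParent i.succ) : Finset (Sym2 (Fin 10))) := by
    ext e
    simp only [Finset.coe_image, Finset.coe_filter, Finset.mem_univ, true_and, Set.mem_image,
      Set.mem_ofPred_eq]
    constructor
    · intro he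
      obtain ⟨i, hi, rfl⟩ := spider_edge_eq (hP he)
      obtain ⟨j, rfl⟩ := Fin.exists_succ_eq.2 hi
      exact ⟨j, he, rfl⟩
    · rintro ⟨i, hi, rfl⟩
      exact hi
  have hinj : Function.Injective fun i : Fin 9 => s(i.succ, spiderParent i.succ) := by decide
  conv_lhs => rw [himage]
  rw [Set.ncard_coe_finset, Finset.card_image_of_injective _ hinj, Finset.card_filter]

/-- For each edge `s(i.succ, spiderParent i.succ)` of the spider, the maximal paths of length at
least two starting with that edge; `(u, v, l)` stands for the path with support `u :: v :: l`. -/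
def spiderRays : Fin 9 → List (Fin 10 × Fin 10 × List (Fin 10)) :=
  ![[(0, 1, [2, 3]), (1, 0, [4, 5, 6]), (1, 0, [7, 8, 9])],
    [(1, 2, [3]), (2, 1, [0, 4, 5, 6]), (2, 1, [0, 7, 8, 9])],
    [(3, 2, [1, 0, 4, 5, 6]), (3, 2, [1, 0, 7, 8, 9])],
    [(0, 4, [5, 6]), (4, 0, [1, 2, 3]), (4, 0, [7, 8, 9])],
    [(4, 5, [6]), (5, 4, [0, 1, 2, 3]), (5, 4, [0, 7, 8, 9])],
    [(6, 5, [4, 0, 1, 2, 3]), (6, 5, [4, 0, 7, 8, 9])],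
    [(0, 7, [8, 9]), (7, 0, [1, 2, 3]), (7, 0, [4, 5, 6])],
    [(7, 8, [9]), (8, 7, [0, 1, 2, 3]), (8, 7, [0, 4, 5, 6])],
    [(9, 8, [7, 0, 1, 2, 3]), (9, 8, [7, 0, 4, 5, 6])]]

lemma spiderRays_spec : ∀ i : Fin 9, ∀ r ∈ spiderRays i,
    s(r.1, r.2.1) = s(i.succ, spiderParent i.succ) ∧
      (r.1 :: r.2.1 :: r.2.2).IsChain spider.Adj ∧ (r.1 :: r.2.1 :: r.2.2).Nodup := by
  decide

/-- The edges of the spider cannot be covered by two subtrees with five edges sharing exactly one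
edge. -/
lemma spider_no_halving {P Q : Set (Sym2 (Fin 10))}
    (hP : ∀ b ∈ spider.edgeSet, b ∉ P → DoesNotCatch spider P {b})
    (hQ : ∀ b ∈ spider.edgeSet, b ∉ Q → DoesNotCatch spider Q {b})
    (hPQ : spider.edgeSet ⊆ P ∪ Q) {c : Sym2 (Fin 10)} (hc : P ∩ Q = {c})
    (hPs : P ⊆ spider.edgeSet) (hcard : P.ncard = 5) : False := by
  classical
  have hcP : c ∈ P ∩ Q := hc ▸ rfl
  rw [ncard_subset_spider_edgeSet hPs] at hcard
  obtain ⟨i, hi, rfl⟩ := spider_edge_eq (hPs hcP.1)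
  obtain ⟨i, rfl⟩ := Fin.exists_succ_eq.2 hi
  have hmono : ∀ r ∈ spiderRays i,
      (∀ e ∈ (r.2.1 :: r.2.2).zipWith (s(·, ·)) r.2.2, e ∈ P) ∨
        (∀ e ∈ (r.2.1 :: r.2.2).zipWith (s(·, ·)) r.2.2, e ∉ P) := by
    rintro ⟨u, v, l⟩ hr
    obtain ⟨huv, hchain, hnodup⟩ := spiderRays_spec i _ hr
    dsimp only at huv hchain hnodup ⊢
    obtain ⟨x, w, hw⟩ : ∃ x, ∃ w : spider.Walk v x, w.support = v :: l :=
      ⟨_, Walk.ofSupport (v :: l) (l.cons_ne_nil v) hchain.of_cons, Walk.support_ofSupport _ _⟩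
    have hpath : (Walk.cons hchain.rel w).IsPath := by
      rwa [Walk.isPath_def, Walk.support_cons, hw]
    have hedges : (v :: l).zipWith (s(·, ·)) l = w.edges := by
      rw [Walk.edges_eq_zipWith_support, hw, List.tail_cons]
    rw [hedges]
    refine (edges_subset_or_subset hP hQ hPQ _ _ hpath (huv ▸ hcP)).imp_right
      fun hwQ e he heP => ?_
    have hec := Set.mem_singleton_iff.1 (hc.subset ⟨heP, hwQ e he⟩)
    have hn := hpath.isTrail.edges_nodup
    rw [Walk.edges_cons, List.nodup_cons, huv, ← hec] at hn
    exact hn.1 he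
  replace hcP := hcP.1
  obtain ⟨h1, h2, h3, h4, h5, h6, h7, h8, h9⟩ :
      s((0 : Fin 10), 1) = s(1, 0) ∧ s((1 : Fin 10), 2) = s(2, 1) ∧ s((2 : Fin 10), 3) = s(3, 2) ∧
      s((0 : Fin 10), 4) = s(4, 0) ∧ s((4 : Fin 10), 5) = s(5, 4) ∧ s((5 : Fin 10), 6) = s(6, 5) ∧
      s((0 : Fin 10), 7) = s(7, 0) ∧ s((7 : Fin 10), 8) = s(8, 7) ∧ s((8 : Fin 10), 9) = s(9, 8) := by
    decide
  clear hc hi hP hQ hPQ hPs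
  simp only [Fin.sum_univ_succ, spiderParent] at hcard
  simp at hcard
  fin_cases i <;> simp [spiderRays, spiderParent] at hmono hcP <;>
    simp only [h1, h2, h3, h4, h5, h6, h7, h8, h9] at hmono <;>
    clear h1 h2 h3 h4 h5 h6 h7 h8 h9
  all_goals
    first
    | obtain ⟨h | h, h' | h', h'' | h''⟩ := hmono <;> simp_all
    | obtain ⟨h | h, h' | h'⟩ := hmono <;> simp_all

/-- There is a finite tree with `9` edges (the number of edges of `CB 5 5`) to which
`CB 5 5` is not friendly. -/
theorem exists_unfriendly_to_cb55 :
    ∃ (V : Type) (_ : Fintype V) (G : SimpleGraph V),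
      G.IsTree ∧ G.edgeSet.ncard = 9 ∧ ¬ Friendly (CB 5 5) G := by
  refine ⟨Fin 10, inferInstance, spider, spider_isTree, ?_, ?_⟩
  · rw [← coe_edgeFinset, Set.ncard_coe_finset, spider_edgeFinset_card]
  rintro ⟨φ, hφ⟩
  have hcenter : (CB 5 5).Adj 0 1 := by decide
  refine spider_no_halving (P := edgeImage φ ((CB 5 5).incidenceSet 0))
    (Q := edgeImage φ ((CB 5 5).incidenceSet 1)) (c := φ ⟨s(0, 1), hcenter⟩)
    (hφ.doesNotCatch_singleton (.inl ⟨rfl, rfl⟩)) (hφ.doesNotCatch_singleton (.inr ⟨rfl, rfl⟩))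
    ?_ ?_ ?_ ?_
  · intro b hb
    obtain ⟨⟨e, he⟩, hφe⟩ := φ.surjective ⟨b, hb⟩
    have hcover : ∀ e ∈ (CB 5 5).edgeSet, 0 ∈ e ∨ 1 ∈ e := by decide
    exact (hcover e he).imp (fun h => ⟨⟨e, he⟩, ⟨he, h⟩, by rw [hφe]⟩)
      (fun h => ⟨⟨e, he⟩, ⟨he, h⟩, by rw [hφe]⟩)
  · ext f
    simp only [edgeImage, Set.mem_inter_iff, Set.mem_ofPred_eq, Set.mem_singleton_iff]
    constructor
    · rintro ⟨⟨e, he, rfl⟩, ⟨e', he', h⟩⟩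
      obtain rfl := φ.injective (Subtype.ext h)
      congr 2
      exact Subtype.ext ((Sym2.mem_and_mem_iff (by decide)).1 ⟨he.2, he'.2⟩)
    · rintro rfl
      exact ⟨⟨⟨s(0, 1), hcenter⟩, ⟨hcenter, Sym2.mem_mk_left _ _⟩, rfl⟩,
        ⟨⟨s(0, 1), hcenter⟩, ⟨hcenter, Sym2.mem_mk_right _ _⟩, rfl⟩⟩
  · rintro _ ⟨e, -, rfl⟩
    exact (φ e).2
  · rw [ncard_edgeImage φ ((CB 5 5).incidenceSet_subset 0), Set.ncard_eq_toFinset_card']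
    decide
end
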